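/- Assume 0 ≤ α < 1/2 and β = 1 (region L₂₃*). Then there exist M > 0 and functions λ₁, λ₃ : ℝ → ℂ such that for every μ > M, λ₁(μ), its complex conjugate, λ₃(μ), and its complex conjugate are roots of g(·, μ), and as μ → ∞: Re λ₁(μ) = −(1/2)μ^(2α−1)(1+o(1)), Im λ₁(μ) = √2 · μ^(1/2)(1+o(1)), Re λ₃(μ) = −(1/2)(1+o(1)), and Im λ₃(μ) = μ^(1/2)(1+o(1)). -/

import Mathlib

open Filter Real Topology

/-- Characteristic polynomial of the thermoelastic system with Cattaneo's law,
without inertial term (`m = 0`), with wave speed `σ = 2`, relaxation `τ = 1`: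
`g(λ, μ) = λ⁴ + λ³ + (μ^(2α)+2μ+μ^β)λ² + (μ^(2α)+2μ)λ + 2μ^(1+β)`. -/
noncomputable def charPoly (α β μ : ℝ) (l : ℂ) : ℂ :=
  l ^ 4 + l ^ 3 +
    ((μ ^ (2 * α) + 2 * μ + μ ^ β : ℝ) : ℂ) * l ^ 2 +
    ((μ ^ (2 * α) + 2 * μ : ℝ) : ℂ) * l + ((2 * μ ^ (1 + β) : ℝ) : ℂ)

/-- The value at `conj l` of a polynomial with real coefficients. -/
lemma charPoly_conj (α β μ : ℝ) (l : ℂ) :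
    charPoly α β μ ((starRingEnd ℂ) l) = (starRingEnd ℂ) (charPoly α β μ l) := by
  simp only [charPoly, map_add, map_mul, map_pow, Complex.conj_ofReal]

/-- The upper root of the quadratic `l² + a l + b`, when `a² ≤ 4 b`. -/
noncomputable def upperRoot (a b : ℝ) : ℂ := ⟨-a / 2, √(b - a ^ 2 / 4)⟩

lemma upperRoot_quadratic {a b : ℝ} (h : 0 ≤ b - a ^ 2 / 4) :
    upperRoot a b ^ 2 + (a : ℂ) * upperRoot a b + (b : ℂ) = 0 := by
  have hs := Real.mul_self_sqrt h
  apply Complex.ext <;> simp [upperRoot, pow_two]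
  · rw [pow_two] at hs
    linarith
  · ring

lemma tendsto_upperRoot_im {a b : ℝ → ℝ} {a₀ c : ℝ} (ha : Tendsto a atTop (𝓝 a₀))
    (hb : Tendsto b atTop (𝓝 c)) :
    Tendsto (fun μ : ℝ => (upperRoot (a μ) (μ * b μ)).im / μ ^ ((1 : ℝ) / 2)) atTop
      (𝓝 (√c)) := by
  have h : Tendsto (fun μ : ℝ => √(b μ - a μ ^ 2 / 4 * μ⁻¹)) atTop (𝓝 (√c)) := by
    have := (hb.sub (((ha.pow 2).div_const 4).mul tendsto_inv_atTop_zero)).sqrt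
    simpa using this
  refine h.congr' ?_
  filter_upwards [eventually_gt_atTop (0 : ℝ)] with μ hμ
  rw [← Real.sqrt_eq_rpow, upperRoot, ← Real.sqrt_div' _ hμ.le]
  congr 1
  field_simp

lemma eventually_sub_sq_nonneg {a b : ℝ → ℝ} {a₀ c : ℝ} (hc : 0 < c)
    (ha : Tendsto a atTop (𝓝 a₀)) (hb : Tendsto b atTop (𝓝 c)) :
    ∀ᶠ μ : ℝ in atTop, 0 ≤ μ * b μ - a μ ^ 2 / 4 := by
  have h : Tendsto (fun μ : ℝ => μ * b μ + -(a μ ^ 2 / 4)) atTop atTop :=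
    (tendsto_id.atTop_mul_pos hc hb).atTop_add ((ha.pow 2).div_const 4).neg
  filter_upwards [h.eventually_ge_atTop 0] with μ hμ
  linarith

/-- After rescaling by `e = μ^(2α-1)` and `n = 1/μ`, the product condition on the constant terms of
two quadratic factors with linear coefficients `t e` and `1 - t e` has a solution `t` near `1`. -/
lemma exists_factor_param {e n : ℝ} (he : 0 < e) (hn : 0 < n) (hen : 300 * (e + n) ≤ 1) :
    ∃ t : ℝ, |t - 1| ≤ 300 * (e + n) ∧
      (2 + e - t * e * (3 + e - t * e * (1 - t * e) * n)) *
        ((1 - t * e) * (3 + e - t * e * (1 - t * e) * n) - 2 - e) = 2 * (1 - 2 * (t * e)) ^ 2 := by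
  let p : ℝ → ℝ := fun t => 1 - t * (1 - t * e) * n
  let r : ℝ → ℝ := fun t => 2 * (p t - 1) + e * ((1 - 3 * t) * (p t - 3 * t - 1) - 3 * t * p t
    - 8 * t ^ 2 - e * t * p t * (1 - 3 * t + (p t - 3 * t - 1)) + e ^ 2 * t ^ 2 * p t ^ 2)
  have hr : ∀ t ∈ Set.Icc (0 : ℝ) 2, |r t| ≤ 300 * (e + n) := by
    rintro t ⟨ht0, ht2⟩
    have hte : 0 ≤ t * e := by positivity
    have hte1 : t * e ≤ 1 := by nlinarith
    have hq0 : 0 ≤ t * (1 - t * e) := mul_nonneg ht0 (by linarith)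
    have hq2 : t * (1 - t * e) ≤ 2 := by nlinarith
    have hp1 : |p t - 1| ≤ 2 * n := by
      rw [abs_le]; constructor <;> simp only [p] <;> nlinarith
    have hpl : |p t| ≤ 1 := by
      rw [abs_le]; constructor <;> simp only [p] <;> nlinarith
    have hp := abs_le.1 hpl
    have hu : |1 - 3 * t| ≤ 5 := by rw [abs_le]; constructor <;> linarith
    have hv : |p t - 3 * t - 1| ≤ 8 := by rw [abs_le]; constructor <;> linarith
    have hw : |1 - 3 * t + (p t - 3 * t - 1)| ≤ 13 :=
      (abs_add_le _ _).trans (by linarith)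
    have htabs : |t| ≤ 2 := by rwa [abs_of_nonneg ht0]
    have heabs : |e| ≤ 1 := by rw [abs_of_pos he]; linarith
    have k1 : |(1 - 3 * t) * (p t - 3 * t - 1)| ≤ 5 * 8 := by rw [abs_mul]; gcongr
    have k2 : |3 * t * p t| ≤ 3 * 2 * 1 := by
      rw [abs_mul, abs_mul, abs_of_pos (three_pos : (0 : ℝ) < 3)]; gcongr
    have k3 : |8 * t ^ 2| ≤ 8 * 2 ^ 2 := by
      rw [abs_mul, abs_pow, abs_of_pos (by norm_num : (0 : ℝ) < 8)]; gcongr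
    have k4 : |e * t * p t * (1 - 3 * t + (p t - 3 * t - 1))| ≤ 1 * 2 * 1 * 13 := by
      rw [abs_mul, abs_mul, abs_mul]; gcongr
    have k5 : |e ^ 2 * t ^ 2 * p t ^ 2| ≤ 1 ^ 2 * 2 ^ 2 * 1 ^ 2 := by
      rw [abs_mul, abs_mul, abs_pow, abs_pow, abs_pow]; gcongr
    rw [abs_le] at k1 k2 k3 k4 k5 hp1 ⊢
    simp only [r]
    constructor <;> nlinarith
  have hc : ContinuousOn (fun t => 1 - t + r t) (Set.Icc 0 2) := by
    simp only [r, p]; fun_prop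
  have h0 := abs_le.1 (hr 0 (by simp))
  have h2 := abs_le.1 (hr 2 (by simp))
  obtain ⟨t, ht, hroot⟩ := intermediate_value_Icc' (by norm_num : (0 : ℝ) ≤ 2) hc
    (show (0 : ℝ) ∈ _ from ⟨by linarith, by linarith⟩)
  refine ⟨t, ?_, ?_⟩
  · rw [show t - 1 = r t by simp only at hroot; linarith]
    exact hr t ht
  · simp only [r, p] at hroot
    linear_combination e * hroot

lemma charPoly_eq_mul {α μ e a b d : ℝ} (he : μ ^ (2 * α) = e * μ)
    (hsum : μ * b + μ * d + a * (1 - a) = e * μ + 3 * μ)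
    (hlin : a * d + (1 - a) * b = e + 2) (hprod : b * d = 2) (hμ : 0 < μ) (l : ℂ) :
    charPoly α 1 μ l = (l ^ 2 + (a : ℂ) * l + ((μ * b : ℝ) : ℂ)) *
      (l ^ 2 + ((1 - a : ℝ) : ℂ) * l + ((μ * d : ℝ) : ℂ)) := by
  have hsq : μ ^ ((1 : ℝ) + 1) = μ ^ 2 := by
    rw [Real.rpow_add hμ, Real.rpow_one, pow_two]
  rw [charPoly, he, hsq, Real.rpow_one]
  have hsum' := congrArg (fun x : ℝ => (x : ℂ)) hsum
  have hlin' := congrArg (fun x : ℝ => (x : ℂ)) hlin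
  have hprod' := congrArg (fun x : ℝ => (x : ℂ)) hprod
  push_cast at hsum' hlin' hprod' ⊢
  linear_combination -l ^ 2 * hsum' - l * (μ : ℂ) * hlin' - (μ : ℂ) ^ 2 * hprod'

theorem charPoly_roots_L23_star (α β : ℝ)
    (h1 : 0 ≤ α) (h2 : α < 1 / 2) (h3 : β = 1) :
    ∃ M > (0 : ℝ), ∃ l1 l3 : ℝ → ℂ,
      (∀ μ > M,
        charPoly α β μ (l1 μ) = 0 ∧ charPoly α β μ ((starRingEnd ℂ) (l1 μ)) = 0 ∧
        charPoly α β μ (l3 μ) = 0 ∧ charPoly α β μ ((starRingEnd ℂ) (l3 μ)) = 0) ∧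
      Tendsto (fun μ : ℝ => (l1 μ).re / (-(1 / 2) * μ ^ (2 * α - 1))) atTop (𝓝 1) ∧
      Tendsto (fun μ : ℝ => (l1 μ).im / (Real.sqrt 2 * μ ^ ((1 : ℝ) / 2))) atTop (𝓝 1) ∧
      Tendsto (fun μ : ℝ => (l3 μ).re / (-(1 / 2) : ℝ)) atTop (𝓝 1) ∧
      Tendsto (fun μ : ℝ => (l3 μ).im / (μ ^ ((1 : ℝ) / 2))) atTop (𝓝 1) := by
  subst h3
  set e : ℝ → ℝ := fun μ => μ ^ (2 * α - 1) with he_def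
  have he : Tendsto e atTop (𝓝 0) := by
    have := tendsto_rpow_neg_atTop (show 0 < 1 - 2 * α by linarith)
    simpa [he_def] using this
  have hn : Tendsto (fun μ : ℝ => μ⁻¹) atTop (𝓝 0) := tendsto_inv_atTop_zero
  have hC : Tendsto (fun μ : ℝ => 300 * (e μ + μ⁻¹)) atTop (𝓝 0) := by
    simpa using (he.add hn).const_mul 300
  have hparam : ∀ μ : ℝ, 0 < μ ∧ 300 * (e μ + μ⁻¹) ≤ 1 → ∃ t : ℝ, |t - 1| ≤ 300 * (e μ + μ⁻¹) ∧
      (2 + e μ - t * e μ * (3 + e μ - t * e μ * (1 - t * e μ) * μ⁻¹)) *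
        ((1 - t * e μ) * (3 + e μ - t * e μ * (1 - t * e μ) * μ⁻¹) - 2 - e μ)
        = 2 * (1 - 2 * (t * e μ)) ^ 2 :=
    fun μ hμ => exists_factor_param (Real.rpow_pos_of_pos hμ.1 _) (inv_pos.2 hμ.1) hμ.2
  choose! t ht hroot using hparam
  have hlarge : ∀ᶠ μ : ℝ in atTop, 0 < μ ∧ 300 * (e μ + μ⁻¹) ≤ 1 :=
    (eventually_gt_atTop 0).and (hC.eventually_le_const one_pos)
  have ht1 : Tendsto t atTop (𝓝 1) := by
    rw [tendsto_iff_norm_sub_tendsto_zero]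
    exact squeeze_zero' (Eventually.of_forall fun _ => norm_nonneg _) (hlarge.mono ht) hC
  set a : ℝ → ℝ := fun μ => t μ * e μ with ha_def
  set s : ℝ → ℝ := fun μ => 3 + e μ - a μ * (1 - a μ) * μ⁻¹ with hs_def
  set b : ℝ → ℝ := fun μ => (2 + e μ - a μ * s μ) / (1 - 2 * a μ) with hb_def
  set d : ℝ → ℝ := fun μ => s μ - b μ with hd_def
  have ha : Tendsto a atTop (𝓝 0) := by simpa using ht1.mul he
  have ha' : Tendsto (fun μ => 1 - a μ) atTop (𝓝 1) := by simpa using ha.const_sub 1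
  have hs : Tendsto s atTop (𝓝 3) := by
    simpa using (he.const_add 3).sub ((ha.mul ha').mul hn)
  have hden : Tendsto (fun μ => 1 - 2 * a μ) atTop (𝓝 1) := by
    simpa using (ha.const_mul 2).const_sub 1
  have hb : Tendsto b atTop (𝓝 2) := by
    have := ((he.const_add 2).sub (ha.mul hs)).div hden one_ne_zero
    norm_num at this
    exact this
  have hd : Tendsto d atTop (𝓝 1) := by
    have := hs.sub hb
    norm_num at this
    exact this
  have hfactor : ∀ᶠ μ : ℝ in atTop, ∀ l : ℂ, charPoly α 1 μ l =
      (l ^ 2 + (a μ : ℂ) * l + ((μ * b μ : ℝ) : ℂ)) *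
      (l ^ 2 + ((1 - a μ : ℝ) : ℂ) * l + ((μ * d μ : ℝ) : ℂ)) := by
    filter_upwards [hlarge, hden.eventually_const_lt one_pos] with μ hμ hpos l
    have hne : 1 - 2 * a μ ≠ 0 := hpos.ne'
    have hbmul : b μ * (1 - 2 * a μ) = 2 + e μ - a μ * s μ := div_mul_cancel₀ _ hne
    have hdmul : d μ * (1 - 2 * a μ) = (1 - a μ) * s μ - 2 - e μ := by
      simp only [hd_def]; linear_combination -hbmul
    refine charPoly_eq_mul (e := e μ) ?_ ?_ ?_ ?_ hμ.1 l
    · simp only [he_def]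
      rw [← Real.rpow_add_one hμ.1.ne']
      ring_nf
    · have : μ * μ⁻¹ = 1 := mul_inv_cancel₀ hμ.1.ne'
      simp only [hd_def, hs_def]
      linear_combination -(a μ * (1 - a μ)) * this
    · simp only [hd_def]
      linear_combination hbmul
    · apply mul_right_cancel₀ (pow_ne_zero 2 hne)
      rw [← hroot μ hμ]
      linear_combination d μ * (1 - 2 * a μ) * hbmul + (2 + e μ - a μ * s μ) * hdmul
  obtain ⟨M, hM⟩ := eventually_atTop.1 (hfactor.and
    ((eventually_sub_sq_nonneg two_pos ha hb).and (eventually_sub_sq_nonneg one_pos ha' hd)))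
  refine ⟨max M 1, by positivity, fun μ => upperRoot (a μ) (μ * b μ),
    fun μ => upperRoot (1 - a μ) (μ * d μ), fun μ hμ => ?_, ?_, ?_, ?_, ?_⟩
  · obtain ⟨hf, hB, hD⟩ := hM μ ((le_max_left _ _).trans hμ.le)
    have r1 : charPoly α 1 μ (upperRoot (a μ) (μ * b μ)) = 0 := by
      rw [hf, upperRoot_quadratic hB, zero_mul]
    have r3 : charPoly α 1 μ (upperRoot (1 - a μ) (μ * d μ)) = 0 := by
      rw [hf, upperRoot_quadratic hD, mul_zero]
    simp only [charPoly_conj, r1, r3, map_zero, and_self]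
  · refine ht1.congr' ?_
    filter_upwards [eventually_gt_atTop (0 : ℝ)] with μ hμ
    have : μ ^ (2 * α - 1) ≠ 0 := (Real.rpow_pos_of_pos hμ _).ne'
    simp only [upperRoot, ha_def, he_def]
    field_simp
  · have := (tendsto_upperRoot_im ha hb).div_const (√2)
    rw [div_self (by positivity)] at this
    refine this.congr fun μ => ?_
    rw [div_div, mul_comm (√2)]
  · have := (ha'.neg.div_const 2).div_const (-(1 / 2))
    norm_num at this
    simpa [upperRoot] using this
  · simpa using tendsto_upperRoot_im ha' hd
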